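/- (Intermediate identity in the proof of Theorem 6.) For all real parameters m > 0, k > 0, γ̄ > 0, γ₀ > 0: (1/ln 2) · ∑_{i=0}^∞ ((m)_i / i!) · (k/m)^i · ∫₀^∞ x^m (k/m + x)^{−m−i} · ln(γ̄ x/(γ₀(k+1))) · e^{−x} dx = log₂(γ̄/(γ₀(k+1))) − γ_E/ln 2, with both sides convergent. -/

import Mathlib

open MeasureTheory Set

/-- Pochhammer symbol (rising factorial) `(m)_i = m(m+1)⋯(m+i−1)`. -/
noncomputable def poch (m : ℝ) (i : ℕ) : ℝ := ∏ j ∈ Finset.range i, (m + j)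

/-- `n`-th harmonic number `H_n = ∑_{j=1}^n 1/j` (with `H_0 = 0`). -/
noncomputable def harmonicR (n : ℕ) : ℝ := ∑ j ∈ Finset.range n, 1 / ((j : ℝ) + 1)

/-- Kummer confluent hypergeometric function `₁F₁(m, 1, z) = ∑_{i=0}^∞ ((m)_i/(i!)²) z^i`. -/
noncomputable def kummerM (m z : ℝ) : ℝ :=
  ∑' i : ℕ, poch m i / ((Nat.factorial i : ℝ) ^ 2) * z ^ i

/-- Kummer confluent hypergeometric function of the second kind
`U(a, b, z) = (1/Γ(a)) ∫₀^∞ e^{−zt} t^{a−1} (1+t)^{b−a−1} dt`. -/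
noncomputable def kummerU (a b z : ℝ) : ℝ :=
  (1 / Real.Gamma a) *
    ∫ t in Ioi (0 : ℝ), Real.exp (-z * t) * t ^ (a - 1) * (1 + t) ^ (b - a - 1)

/-- Conditional SNR density of the fdRLoS channel,
`f(γ|x)` with `k_x = k/x`, `γ̄_x = ((k+x)/(k+1))·γ̄`. -/
noncomputable def condPdf (m k γb x γ : ℝ) : ℝ :=
  (m ^ m * (1 + k / x)) / ((m + k / x) ^ m * ((k + x) / (k + 1) * γb)) *
    Real.exp (-((1 + k / x) / ((k + x) / (k + 1) * γb)) * γ) *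
    kummerM m ((k / x) * (1 + k / x) / (k / x + m) * (γ / ((k + x) / (k + 1) * γb)))

/-- Unconditional SNR density of the fdRLoS channel, `f(γ) = ∫₀^∞ f(γ|x) e^{−x} dx`. -/
noncomputable def pdfSNR (m k γb γ : ℝ) : ℝ :=
  ∫ x in Ioi (0 : ℝ), condPdf m k γb x γ * Real.exp (-x)

lemma poch_pos' (m : ℝ) (hm : 0 < m) (i : ℕ) : 0 < poch m i := by
  unfold poch
  exact Finset.prod_pos fun j _ => by positivity

lemma poch_eq (m : ℝ) (i : ℕ) :
    poch m i / (Nat.factorial i : ℝ) = Ring.choose (m + i - 1) i := by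
  have h := Ring.factorial_nsmul_multichoose_eq_ascPochhammer m i
  have h2 : Ring.choose (m + i - 1) i = Ring.multichoose m i := by
    rw [Ring.choose]
    congr 1
    ring
  have h3 : (ascPochhammer ℕ i).smeval m = poch m i := by
    rw [Polynomial.ascPochhammer_smeval_eq_eval]
    unfold poch
    induction i with
    | zero => simp
    | succ n ih =>
      rw [ascPochhammer_succ_eval, Finset.prod_range_succ]
      rw [ih]
      · exact Ring.factorial_nsmul_multichoose_eq_ascPochhammer m n
      · rw [Ring.choose]
        congr 1
        ring
  rw [h2, div_eq_iff (by positivity), ← h3, ← h, nsmul_eq_mul, mul_comm]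

lemma hasSum_poch (m t : ℝ) (ht : |t| < 1) :
    HasSum (fun i : ℕ => poch m i / (Nat.factorial i : ℝ) * t ^ i) (1 / (1 - t) ^ m) := by
  have h := (Real.one_div_one_sub_rpow_hasFPowerSeriesOnBall_zero m).hasSum
    (y := t) (by simpa [← ENNReal.ofReal_one, Metric.eball_ofReal] using ht)
  simp only [zero_add] at h
  refine Eq.mp (congrArg (fun f : ℕ → ℝ => HasSum f (1 / (1 - t) ^ m)) (funext fun i => ?_)) h
  rw [poch_eq]
  simp [FormalMultilinearSeries.ofScalars, mul_comm]

lemma hasSum_weight (m c x : ℝ) (hc : 0 < c) (hx : 0 < x) :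
    HasSum (fun i : ℕ => poch m i / (Nat.factorial i : ℝ) * c ^ i *
      (x ^ m * (c + x) ^ (-(m + (i : ℝ))))) 1 := by
  have hcx : 0 < c + x := by positivity
  have ht : |c / (c + x)| < 1 := by
    rw [abs_of_pos (by positivity), div_lt_one hcx]
    linarith
  have h := (hasSum_poch m _ ht).mul_right (x ^ m * (c + x) ^ (-m))
  have e1 : 1 - c / (c + x) = x / (c + x) := by field_simp; ring
  have hxm : x ^ m ≠ 0 := (Real.rpow_pos_of_pos hx m).ne'
  have hcm : (c + x) ^ m ≠ 0 := (Real.rpow_pos_of_pos hcx m).ne'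
  rw [e1, Real.div_rpow hx.le hcx.le, Real.rpow_neg hcx.le] at h
  have e2 : 1 / (x ^ m / (c + x) ^ m) * (x ^ m * ((c + x) ^ m)⁻¹) = 1 := by field_simp
  rw [e2] at h
  refine Eq.mp (congrArg (fun f : ℕ → ℝ => HasSum f 1) (funext fun i => ?_)) h
  · rw [neg_add, Real.rpow_add hcx, Real.rpow_neg hcx.le, Real.rpow_neg hcx.le, Real.rpow_natCast,
      div_pow]
    ring

lemma integral_log_exp :
    ∫ x in Ioi (0 : ℝ), Real.log x * Real.exp (-x) = -Real.eulerMascheroniConstant := by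
  have h := Complex.hasDerivAt_GammaIntegral (s := 1) (by simp)
  have h2 : HasDerivAt Complex.Gamma
      (∫ t : ℝ in Ioi 0, (t : ℂ) ^ ((1 : ℂ) - 1) * (Real.log t * Real.exp (-t))) 1 := by
    apply h.congr_of_eventuallyEq
    have : {s : ℂ | 0 < s.re} ∈ nhds (1 : ℂ) :=
      (isOpen_lt continuous_const Complex.continuous_re).mem_nhds (by simp)
    filter_upwards [this] with a ha using Complex.Gamma_eq_integral ha
  have h3 := h2.unique Complex.hasDerivAt_Gamma_one
  simp only [sub_self, Complex.cpow_zero, one_mul] at h3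
  apply Complex.ofReal_injective
  rw [← integral_complex_ofReal]
  push_cast
  simpa using h3

lemma integrable_log_exp :
    IntegrableOn (fun x : ℝ => Real.log x * Real.exp (-x)) (Ioi 0) := by
  by_contra hcon
  have h := integral_undef hcon
  rw [integral_log_exp] at h
  have := Real.one_half_lt_eulerMascheroniConstant
  linarith

/-- Intermediate identity in the proof of Theorem 6:
`(1/ln 2) ∑_i ((m)_i/i!) (k/m)^i ∫₀^∞ x^m (k/m + x)^{−m−i} ln(γ̄x/(γ₀(k+1))) e^{−x} dx
  = log₂(γ̄/(γ₀(k+1))) − γ_E/ln 2`. -/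
theorem opra_highSNR_log_part (m k γb γ₀ : ℝ) (hm : 0 < m) (hk : 0 < k) (hγb : 0 < γb)
    (hγ₀ : 0 < γ₀) :
    (∀ i : ℕ, IntegrableOn (fun x : ℝ =>
      x ^ m * (k / m + x) ^ (-(m + (i : ℝ))) *
        Real.log (γb * x / (γ₀ * (k + 1))) * Real.exp (-x)) (Ioi 0)) ∧
    Summable (fun i : ℕ => poch m i / (Nat.factorial i : ℝ) * (k / m) ^ i *
      ∫ x in Ioi (0 : ℝ), x ^ m * (k / m + x) ^ (-(m + (i : ℝ))) *
        Real.log (γb * x / (γ₀ * (k + 1))) * Real.exp (-x)) ∧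
    (1 / Real.log 2) * (∑' i : ℕ, poch m i / (Nat.factorial i : ℝ) * (k / m) ^ i *
      ∫ x in Ioi (0 : ℝ), x ^ m * (k / m + x) ^ (-(m + (i : ℝ))) *
        Real.log (γb * x / (γ₀ * (k + 1))) * Real.exp (-x)) =
      Real.logb 2 (γb / (γ₀ * (k + 1))) -
        Real.eulerMascheroniConstant / Real.log 2 := by
  set c := k / m with hc_def
  have hc : 0 < c := div_pos hk hm
  set A := γb / (γ₀ * (k + 1)) with hA_def
  have hA : 0 < A := by positivity
  have hlog : ∀ x ∈ Ioi (0 : ℝ), Real.log (γb * x / (γ₀ * (k + 1))) * Real.exp (-x) =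
      Real.log A * Real.exp (-x) + Real.log x * Real.exp (-x) := by
    intro x hx
    have : γb * x / (γ₀ * (k + 1)) = A * x := by rw [hA_def]; ring
    rw [this, Real.log_mul hA.ne' (ne_of_gt hx)]
    ring
  have hexp : IntegrableOn (fun x : ℝ => Real.exp (-x)) (Ioi 0) := integrableOn_exp_neg_Ioi 0
  have hg : IntegrableOn (fun x : ℝ =>
      Real.log (γb * x / (γ₀ * (k + 1))) * Real.exp (-x)) (Ioi 0) :=
    IntegrableOn.congr_fun ((hexp.const_mul (Real.log A)).add integrable_log_exp)
      (fun x hx => (hlog x hx).symm) measurableSet_Ioi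
  have hgint : ∫ x in Ioi (0 : ℝ), Real.log (γb * x / (γ₀ * (k + 1))) * Real.exp (-x) =
      Real.log A - Real.eulerMascheroniConstant := by
    rw [setIntegral_congr_fun measurableSet_Ioi hlog,
      integral_add (hexp.const_mul (Real.log A)) integrable_log_exp, integral_const_mul,
      integral_log_exp, integral_exp_neg_Ioi_zero]
    ring
  set g : ℝ → ℝ := fun x => Real.log (γb * x / (γ₀ * (k + 1))) * Real.exp (-x) with hg_def
  let a : ℕ → ℝ := fun i => poch m i / (Nat.factorial i : ℝ) * c ^ i
  have ha : ∀ i, 0 < a i := fun i => by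
    have := poch_pos' m hm i
    positivity
  let w : ℕ → ℝ → ℝ := fun i x => x ^ m * (c + x) ^ (-(m + (i : ℝ)))
  have hw : ∀ i, ∀ x ∈ Ioi (0 : ℝ), 0 ≤ w i x := fun i x hx => by
    have hx' : (0 : ℝ) < x := hx
    positivity
  have hsum : ∀ x ∈ Ioi (0 : ℝ), HasSum (fun i => a i * w i x) 1 := fun x hx =>
    hasSum_weight m c x hc hx
  have hle : ∀ i, ∀ x ∈ Ioi (0 : ℝ), a i * w i x ≤ 1 := fun i x hx =>
    le_hasSum (hsum x hx) i fun j _ => mul_nonneg (ha j).le (hw j x hx)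
  have hwm : ∀ i, Measurable (w i) := fun i => by
    simp only [w]
    fun_prop
  have hFi : ∀ i, IntegrableOn (fun x => a i * w i x * g x) (Ioi 0) := fun i => by
    refine Integrable.mono' hg.norm
      ((((hwm i).const_mul (a i)).aestronglyMeasurable).mul hg.aestronglyMeasurable) ?_
    refine (ae_restrict_iff' measurableSet_Ioi).2 (Filter.Eventually.of_forall fun x hx => ?_)
    rw [norm_mul, Real.norm_of_nonneg (mul_nonneg (ha i).le (hw i x hx))]
    exact mul_le_of_le_one_left (norm_nonneg _) (hle i x hx)
  have hH : HasSum (fun i => ∫ x in Ioi (0 : ℝ), a i * w i x * g x)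
      (∫ x in Ioi (0 : ℝ), g x) := by
    have hbs : ∀ x ∈ Ioi (0 : ℝ), HasSum (fun i => a i * w i x * ‖g x‖) ‖g x‖ := fun x hx => by
      simpa using (hsum x hx).mul_right ‖g x‖
    refine hasSum_integral_of_dominated_convergence (fun i x => a i * w i x * ‖g x‖)
      (fun i => (hFi i).aestronglyMeasurable) (fun i => ?_) ?_ ?_ ?_
    · refine (ae_restrict_iff' measurableSet_Ioi).2 (Filter.Eventually.of_forall fun x hx => ?_)
      rw [norm_mul, Real.norm_of_nonneg (mul_nonneg (ha i).le (hw i x hx))]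
    · exact (ae_restrict_iff' measurableSet_Ioi).2
        (Filter.Eventually.of_forall fun x hx => (hbs x hx).summable)
    · exact IntegrableOn.congr_fun hg.norm (fun x hx => (hbs x hx).tsum_eq.symm) measurableSet_Ioi
    · refine (ae_restrict_iff' measurableSet_Ioi).2 (Filter.Eventually.of_forall fun x hx => ?_)
      simpa using (hsum x hx).mul_right (g x)
  have hterm : ∀ i : ℕ, (fun x : ℝ => x ^ m * (c + x) ^ (-(m + (i : ℝ))) *
      Real.log (γb * x / (γ₀ * (k + 1))) * Real.exp (-x)) = fun x => w i x * g x := fun i => by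
    funext x
    simp only [w, hg_def]
    ring
  simp only [hterm]
  have hH2 : HasSum (fun i : ℕ => poch m i / (Nat.factorial i : ℝ) * c ^ i *
      ∫ x in Ioi (0 : ℝ), w i x * g x) (Real.log A - Real.eulerMascheroniConstant) := by
    rw [← hgint]
    convert hH using 2 with i
    rw [← integral_const_mul]
    simp only [a, mul_assoc]
  refine ⟨fun i => ?_, hH2.summable, ?_⟩
  · have h := (hFi i).const_mul (a i)⁻¹
    refine h.congr (Filter.Eventually.of_forall fun x => ?_)
    have := (ha i).ne'
    simp only
    field_simp
  · rw [hH2.tsum_eq, Real.logb]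
    ring
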